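/- Let (Z, C) be a pair of random variables taking values in finite types with joint probability mass function μ, with marginals μ_Z and μ_C, and let M ≥ 2 be an integer. Then Σ_{(z,c) : μ(z,c)>0} μ(z,c) · log( 1 + (M − 1) · μ_Z(z) · μ_C(c) / μ(z,c) ) ≥ log(M − 1) − I(Z; C). Equivalently, log(M − 1) minus the idealized optimal InfoNCE loss E_{(z,c)∼μ}[ log( 1 + (M − 1) · μ_Z(z)/μ(z | c) ) ] is at most the mutual information I(Z; C). -/

import Mathlib

/-!
STATEMENT 3 (core of paper Lemma A.3 / Eq. (4)): for a joint pmf μ of `(Z, C)` and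
batch size `M ≥ 2`, the idealized optimal InfoNCE loss
`E_{(z,c)∼μ}[ log( 1 + (M−1) μ_Z(z) μ_C(c) / μ(z,c) ) ]`
is at least `log(M − 1) − I(Z; C)`.
-/

open Finset

/-- Marginal over the first coordinate: `μ_Z(z) = ∑ c, μ(z, c)`. -/
noncomputable def margFst {Z C : Type*} [Fintype C] (μ : Z → C → ℝ) (z : Z) : ℝ :=
  ∑ c, μ z c

/-- Marginal over the second coordinate: `μ_C(c) = ∑ z, μ(z, c)`. -/
noncomputable def margSnd {Z C : Type*} [Fintype Z] (μ : Z → C → ℝ) (c : C) : ℝ :=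
  ∑ z, μ z c

/-- Mutual information of a joint pmf on finite types. -/
noncomputable def mutualInfo {Z C : Type*} [Fintype Z] [Fintype C] (μ : Z → C → ℝ) : ℝ :=
  ∑ z, ∑ c,
    if 0 < μ z c then μ z c * Real.log (μ z c / (margFst μ z * margSnd μ c)) else 0

/-- A single term of the InfoNCE bound: `log r + log (q / p) ≤ log (1 + r q / p)`, weighted by
`p`, where `q = a b`. -/
theorem mul_log_sub_mul_log_div_le {p a b r : ℝ} (hp : 0 < p) (ha : 0 < a) (hb : 0 < b)
    (hr : 0 < r) :
    p * Real.log r - p * Real.log (p / (a * b)) ≤ p * Real.log (1 + r * a * b / p) := by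
  rw [← mul_sub, ← Real.log_div hr.ne' (by positivity)]
  have h : r / (p / (a * b)) = r * a * b / p := by field_simp
  rw [h]
  gcongr
  linarith

/-- **InfoNCE mutual-information bound**: the idealized optimal InfoNCE loss with
batch size `M` is at least `log(M − 1) − I(Z; C)`. -/
theorem log_sub_mutualInfo_le_infoNCE {Z C : Type*} [Fintype Z] [Fintype C]
    (μ : Z → C → ℝ) (hnn : ∀ z c, 0 ≤ μ z c) (hsum : ∑ z, ∑ c, μ z c = 1)
    (M : ℕ) (hM : 2 ≤ M) :
    Real.log ((M : ℝ) - 1) - mutualInfo μ ≤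
      ∑ z, ∑ c,
        if 0 < μ z c then
          μ z c * Real.log (1 + ((M : ℝ) - 1) * margFst μ z * margSnd μ c / μ z c)
        else 0 := by
  have hr : (0 : ℝ) < (M : ℝ) - 1 := by
    have : (2 : ℝ) ≤ M := by exact_mod_cast hM
    linarith
  have hlog : Real.log ((M : ℝ) - 1) = ∑ z, ∑ c, μ z c * Real.log ((M : ℝ) - 1) := by
    simp_rw [← Finset.sum_mul, hsum, one_mul]
  rw [hlog, mutualInfo]
  simp_rw [← Finset.sum_sub_distrib]
  refine Finset.sum_le_sum fun z _ => Finset.sum_le_sum fun c _ => ?_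
  split_ifs with hp
  · have ha : 0 < margFst μ z :=
      hp.trans_le (Finset.single_le_sum (fun c _ => hnn z c) (Finset.mem_univ c))
    have hb : 0 < margSnd μ c :=
      hp.trans_le (Finset.single_le_sum (f := fun z => μ z c) (fun z _ => hnn z c)
        (Finset.mem_univ z))
    exact mul_log_sub_mul_log_div_le hp ha hb hr
  · simp [le_antisymm (not_lt.mp hp) (hnn z c)]
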